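/- Fix μ ∈ ℝ, σ > 0, p ∈ (0,1) and γ ∈ (0,1). Then the Chernoff coefficient of the t-parametrized Gaussian model satisfies lim_{t → ∞} C_p^γ(t) = p^{1−γ}. -/

import Mathlib

open MeasureTheory Real Filter

/-- Gaussian probability density with mean `m` and variance `v`. -/
noncomputable def gaussPdf (m v y : ℝ) : ℝ :=
  Real.exp (-(y - m) ^ 2 / (2 * v)) / Real.sqrt (2 * Real.pi * v)

theorem gaussPdf_eq_real (m v y : ℝ) (hv : 0 ≤ v) :
    gaussPdf m v y = ProbabilityTheory.gaussianPDFReal m ⟨v, hv⟩ y := by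
  unfold gaussPdf ProbabilityTheory.gaussianPDFReal
  rw [div_eq_mul_inv, mul_comm]
  rfl

theorem gaussPdf_integrable (m v : ℝ) (hv : 0 ≤ v) : Integrable (gaussPdf m v) := by
  have : gaussPdf m v = ProbabilityTheory.gaussianPDFReal m ⟨v, hv⟩ := by
    funext y; exact gaussPdf_eq_real m v y hv
  rw [this]
  exact ProbabilityTheory.integrable_gaussianPDFReal _ _

theorem gaussPdf_integral (m v : ℝ) (hv : 0 < v) : ∫ y, gaussPdf m v y = 1 := by
  have : gaussPdf m v = ProbabilityTheory.gaussianPDFReal m ⟨v, hv.le⟩ := by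
    funext y; exact gaussPdf_eq_real m v y hv.le
  rw [this]
  apply ProbabilityTheory.integral_gaussianPDFReal_eq_one
  intro h
  exact hv.ne' (congrArg NNReal.toReal h)

theorem gaussPdf_nonneg' (m v y : ℝ) : 0 ≤ gaussPdf m v y := by
  unfold gaussPdf; positivity

theorem gaussPdf_meas (m v : ℝ) : Measurable (gaussPdf m v) := by
  unfold gaussPdf; fun_prop

theorem gaussPdf_le' (m v w y : ℝ) (hw : 0 < w) (hwv : w ≤ v) :
    gaussPdf m v y ≤ 1 / √(2 * π * w) := by
  unfold gaussPdf
  have hv : 0 < v := hw.trans_le hwv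
  have hpi := Real.pi_pos
  gcongr
  rw [Real.exp_le_one_iff]
  apply div_nonpos_of_nonpos_of_nonneg
  · nlinarith [sq_nonneg (y - m)]
  · positivity

theorem gaussPdf_rpow (v a y : ℝ) :
    gaussPdf 0 v y ^ a = Real.exp (-(a / (2 * v)) * y ^ 2) * (√(2 * π * v) ^ a)⁻¹ := by
  unfold gaussPdf
  rw [Real.div_rpow (Real.exp_nonneg _) (Real.sqrt_nonneg _), ← Real.exp_mul, div_eq_mul_inv]
  congr 2
  ring

theorem gaussPdf_rpow_integrable (v a : ℝ) (hv : 0 < v) (ha : 0 < a) :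
    Integrable (fun y => gaussPdf 0 v y ^ a) := by
  simp_rw [gaussPdf_rpow]
  exact (integrable_exp_neg_mul_sq (by positivity)).mul_const _

theorem gaussPdf_rpow_integral (v a : ℝ) (hv : 0 < v) (ha : 0 < a) :
    ∫ y, gaussPdf 0 v y ^ a = √(2 * π * v) ^ (1 - a) / √a := by
  simp_rw [gaussPdf_rpow]
  rw [integral_mul_const, integral_gaussian]
  have hpi := Real.pi_pos
  have h : π / (a / (2 * v)) = (2 * π * v) / a := by field_simp
  have hA : 0 < √(2 * π * v) := by positivity
  rw [h, Real.sqrt_div (by positivity), Real.rpow_sub hA, Real.rpow_one]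
  field_simp

/-- The Chernoff coefficient `C_p^γ(t)` converges to `p^{1−γ}` as `t → ∞`. -/
theorem chernoff_high_snr_limit (μ σ p γ : ℝ) (hσ : 0 < σ)
    (hp : p ∈ Set.Ioo (0 : ℝ) 1) (hγ : γ ∈ Set.Ioo (0 : ℝ) 1)
    (Cp : ℝ → ℝ)
    (hCp : ∀ t : ℝ, Cp t = ∫ y : ℝ,
      (gaussPdf μ (σ ^ 2 * (1 + 1 / t)) y) ^ γ *
        (p * gaussPdf μ (σ ^ 2 * (1 + 1 / t)) y
          + (1 - p) * gaussPdf 0 (σ ^ 2 / t) y) ^ (1 - γ)) :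
    Filter.Tendsto Cp Filter.atTop (nhds (p ^ (1 - γ))) := by
  obtain ⟨hp0, hp1⟩ := hp
  obtain ⟨hg0, hg1⟩ := hγ
  have hq : 0 < 1 - p := by linarith
  have ha : 0 < 1 - γ := by linarith
  set K : ℝ := (1 / √(2 * π * σ ^ 2)) ^ γ * (1 - p) ^ (1 - γ) with hK
  have key : ∀ t : ℝ, 0 < t → p ^ (1 - γ) ≤ Cp t ∧
      Cp t ≤ p ^ (1 - γ) + K * (√(2 * π * (σ ^ 2 / t)) ^ γ / √(1 - γ)) := by
    intro t ht
    have hs : 0 < σ ^ 2 := by positivity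
    have hv : 0 < σ ^ 2 * (1 + 1 / t) := by positivity
    have hw : 0 < σ ^ 2 / t := by positivity
    have hle : σ ^ 2 ≤ σ ^ 2 * (1 + 1 / t) := by
      have : 0 < 1 / t := by positivity
      nlinarith
    rw [hCp t]
    generalize σ ^ 2 * (1 + 1 / t) = v at *
    generalize σ ^ 2 / t = w at *
    have hsplit : ∀ y, gaussPdf μ v y ^ γ * (p * gaussPdf μ v y) ^ (1 - γ)
        = p ^ (1 - γ) * gaussPdf μ v y := by
      intro y
      have h1 : gaussPdf μ v y ^ γ * gaussPdf μ v y ^ (1 - γ) = gaussPdf μ v y := by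
        rw [← Real.rpow_add_of_nonneg (gaussPdf_nonneg' _ _ _) hg0.le ha.le]
        simp
      rw [Real.mul_rpow hp0.le (gaussPdf_nonneg' _ _ _)]
      linear_combination p ^ (1 - γ) * h1
    have hlow : ∀ y, p ^ (1 - γ) * gaussPdf μ v y ≤ gaussPdf μ v y ^ γ *
        (p * gaussPdf μ v y + (1 - p) * gaussPdf 0 w y) ^ (1 - γ) := by
      intro y
      rw [← hsplit y]
      have h1 := gaussPdf_nonneg' μ v y
      have h0 := gaussPdf_nonneg' 0 w y
      have : 0 ≤ (1 - p) * gaussPdf 0 w y := by positivity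
      gcongr
      linarith
    have hup : ∀ y, gaussPdf μ v y ^ γ *
        (p * gaussPdf μ v y + (1 - p) * gaussPdf 0 w y) ^ (1 - γ)
        ≤ p ^ (1 - γ) * gaussPdf μ v y + K * gaussPdf 0 w y ^ (1 - γ) := by
      intro y
      have h1 := gaussPdf_nonneg' μ v y
      have h0 := gaussPdf_nonneg' 0 w y
      have hadd := Real.rpow_add_le_add_rpow (p := 1 - γ) (mul_nonneg hp0.le h1)
        (mul_nonneg hq.le h0) ha.le (by linarith)
      have hb := gaussPdf_le' μ v (σ ^ 2) y hs hle
      calc _ ≤ gaussPdf μ v y ^ γ * ((p * gaussPdf μ v y) ^ (1 - γ)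
              + ((1 - p) * gaussPdf 0 w y) ^ (1 - γ)) := by gcongr
        _ = p ^ (1 - γ) * gaussPdf μ v y +
            gaussPdf μ v y ^ γ * (1 - p) ^ (1 - γ) * gaussPdf 0 w y ^ (1 - γ) := by
          rw [mul_add, hsplit, Real.mul_rpow hq.le h0, mul_assoc]
        _ ≤ _ := by
          rw [hK]
          gcongr
    have hi1 : Integrable (fun y => p ^ (1 - γ) * gaussPdf μ v y) :=
      (gaussPdf_integrable μ v hv.le).const_mul _
    have hi2 : Integrable (fun y => K * gaussPdf 0 w y ^ (1 - γ)) :=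
      (gaussPdf_rpow_integrable w _ hw ha).const_mul _
    have hi : Integrable (fun y => gaussPdf μ v y ^ γ *
        (p * gaussPdf μ v y + (1 - p) * gaussPdf 0 w y) ^ (1 - γ)) := by
      refine (hi1.add hi2).mono' ?_ (Eventually.of_forall fun y => ?_)
      · have m1 := gaussPdf_meas μ v
        have m2 := gaussPdf_meas 0 w
        exact Measurable.aestronglyMeasurable (by fun_prop)
      · rw [Real.norm_of_nonneg]
        · exact hup y
        · exact le_trans (mul_nonneg (by positivity) (gaussPdf_nonneg' _ _ _)) (hlow y)
    constructor
    · have := integral_mono hi1 hi hlow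
      rwa [integral_const_mul, gaussPdf_integral μ v hv, mul_one] at this
    · have := integral_mono hi (hi1.add hi2) hup
      have h2 := integral_add hi1 hi2
      rw [integral_const_mul, gaussPdf_integral μ v hv, mul_one, integral_const_mul,
        gaussPdf_rpow_integral w _ hw ha, sub_sub_cancel] at h2
      exact this.trans h2.le
  have hlim : Tendsto (fun t : ℝ => p ^ (1 - γ) +
      K * (√(2 * π * (σ ^ 2 / t)) ^ γ / √(1 - γ))) atTop (nhds (p ^ (1 - γ))) := by
    have h1 : Tendsto (fun t : ℝ => σ ^ 2 / t) atTop (nhds 0) :=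
      tendsto_const_nhds.div_atTop tendsto_id
    have hc : ContinuousAt (fun x : ℝ => p ^ (1 - γ) +
        K * (√(2 * π * x) ^ γ / √(1 - γ))) 0 := by
      have : ContinuousAt (fun x : ℝ => √(2 * π * x) ^ γ) 0 :=
        ContinuousAt.rpow_const (by fun_prop) (Or.inr hg0.le)
      exact continuousAt_const.add (continuousAt_const.mul (this.div_const _))
    have h2 := hc.tendsto.comp h1
    simpa [Function.comp_def, Real.zero_rpow hg0.ne'] using h2
  refine tendsto_of_tendsto_of_tendsto_of_le_of_le' tendsto_const_nhds hlim ?_ ?_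
  · filter_upwards [eventually_gt_atTop 0] with t ht using (key t ht).1
  · filter_upwards [eventually_gt_atTop 0] with t ht using (key t ht).2
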